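/- arXiv:2512.24817 — 3 statements merged into one kernel-verified Lean document; each statement's English description precedes it below -/
import Mathlib

section
/- Let k ≥ 2 be an integer and let G = GL₂(ℤ/2^kℤ). Then S(B₀(2^k)) = {0} ∪ {2^m : 1 ≤ m ≤ k} ∪ {2^k + 2^{k-1}}; that is, a natural number m satisfies #{g ∈ G : gRg⁻¹ ⊆ B₀(2^k)} = m · #B₀(2^k) for some subgroup R of G if and only if m lies in this set. -/
open Matrix

abbrev GL2 (N : ℕ) := GL (Fin 2) (ZMod N)

/-- The Borel subgroup `B₀(N)` of upper-triangular matrices, as a set. -/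
def B0 (N : ℕ) : Set (GL2 N) :=
  {g | (g : Matrix (Fin 2) (Fin 2) (ZMod N)) 1 0 = 0}

/-- The number of `g` with `g R g⁻¹ ⊆ H`. -/
noncomputable def conjCount {N : ℕ} (H : Set (GL2 N)) (R : Subgroup (GL2 N)) : ℕ :=
  Nat.card {g : GL2 N | ∀ r ∈ R, g * r * g⁻¹ ∈ H}

/-- `S(H)`: the set of `m` with `#{g : gRg⁻¹ ⊆ H} = m * #H` for some subgroup `R`. -/
def Sset {N : ℕ} (H : Set (GL2 N)) : Set ℕ :=
  {m | ∃ R : Subgroup (GL2 N), conjCount H R = m * Nat.card H}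

/-- The Borel subgroup as a subgroup of `GL₂`. -/
def borelSubgroup (N : ℕ) : Subgroup (GL2 N) where
  carrier := B0 N
  one_mem' := by simp [B0]
  mul_mem' := by
    intro a b ha hb
    simp only [B0, Set.mem_ofPred_eq] at *
    simp [Matrix.mul_apply, Fin.sum_univ_two, ha, hb]
  inv_mem' := by
    intro a ha
    simp only [B0, Set.mem_ofPred_eq] at *
    simp [Matrix.inv_def, Matrix.adjugate_fin_two, ha]

/-- The unipotent matrix with bottom row `(x, 1)`. -/
def lowerUnipotent {N : ℕ} (x : ZMod N) : GL2 N where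
  val := !![1, 0; x, 1]
  inv := !![1, 0; -x, 1]
  val_inv := by simp [Matrix.one_fin_two]
  inv_val := by simp [Matrix.one_fin_two]

/-- An antidiagonal times a unipotent matrix, with bottom row `(1, y)`. -/
def swapUnipotent {N : ℕ} (y : ZMod N) : GL2 N where
  val := !![0, 1; 1, y]
  inv := !![-y, 1; 1, 0]
  val_inv := by simp [Matrix.one_fin_two]
  inv_val := by simp [Matrix.one_fin_two]

/-- The unipotent matrix with top row `(1, y)`. -/
def upperUnipotent {N : ℕ} (y : ZMod N) : GL2 N where
  val := !![1, y; 0, 1]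
  inv := !![1, -y; 0, 1]
  val_inv := by simp [Matrix.one_fin_two]
  inv_val := by simp [Matrix.one_fin_two]

/-- The diagonal matrix with entries `1` and `u`. -/
def diagOne {N : ℕ} (u : (ZMod N)ˣ) : GL2 N where
  val := !![1, 0; 0, (u : ZMod N)]
  inv := !![1, 0; 0, ((u⁻¹ : (ZMod N)ˣ) : ZMod N)]
  val_inv := by simp [Matrix.one_fin_two]
  inv_val := by simp [Matrix.one_fin_two]

/-- The elements conjugating every member of `S` into the Borel subgroup. -/
def conjugators {N : ℕ} (S : Set (GL2 N)) : Set (GL2 N) :=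
  {g | ∀ r ∈ S, g * r * g⁻¹ ∈ B0 N}

/-- The fixed points of `S` on the chart `(x : 1)` of the projective line. -/
def affineFixed {N : ℕ} (S : Set (GL2 N)) : Set (ZMod N) :=
  {x | ∀ r ∈ S, r 1 0 + x * (r 0 0 - r 1 1) - r 0 1 * x ^ 2 = 0}

/-- The solutions `y` of the equations saying that `S` fixes the point `(1 : y)`. -/
def oppositeFixed {N : ℕ} (S : Set (GL2 N)) : Set (ZMod N) :=
  {y | ∀ r ∈ S, r 0 1 + y * (r 1 1 - r 0 0) - r 1 0 * y ^ 2 = 0}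

/-- The number of points of the projective line over `ZMod N` fixed by `S`. -/
noncomputable def numFixed {N : ℕ} (S : Set (GL2 N)) : ℕ :=
  Nat.card (affineFixed S) + Nat.card {y | ¬ IsUnit y ∧ y ∈ oppositeFixed S}

theorem lowerUnipotent_mem_conjugators {N : ℕ} {S : Set (GL2 N)} {x : ZMod N} :
    lowerUnipotent x ∈ conjugators S ↔ x ∈ affineFixed S := by
  refine forall₂_congr fun r _ => ?_
  simp only [B0, Set.mem_ofPred_eq, lowerUnipotent, Units.val_mul, ← Units.inv_eq_val_inv,
    Matrix.mul_apply, Fin.sum_univ_two]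
  refine Eq.congr_left ?_
  simp
  ring

theorem swapUnipotent_mem_conjugators {N : ℕ} {S : Set (GL2 N)} {y : ZMod N} :
    swapUnipotent y ∈ conjugators S ↔ y ∈ oppositeFixed S := by
  refine forall₂_congr fun r _ => ?_
  simp only [B0, Set.mem_ofPred_eq, swapUnipotent, Units.val_mul, ← Units.inv_eq_val_inv,
    Matrix.mul_apply, Fin.sum_univ_two]
  refine Eq.congr_left ?_
  simp
  ring

theorem borel_mul_mem_conjugators {N : ℕ} {S : Set (GL2 N)} {b g : GL2 N}
    (hb : b ∈ borelSubgroup N) :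
    b * g ∈ conjugators S ↔ g ∈ conjugators S := by
  refine forall₂_congr fun r _ => ?_
  change _ ∈ borelSubgroup N ↔ _ ∈ borelSubgroup N
  rw [show b * g * r * (b * g)⁻¹ = b * (g * r * g⁻¹) * b⁻¹ by group,
    Subgroup.mul_mem_cancel_right _ (inv_mem hb), Subgroup.mul_mem_cancel_left _ hb]

theorem mem_conjugators_iff {N : ℕ} {S : Set (GL2 N)} {g : GL2 N} :
    g ∈ conjugators S ↔ S ⊆ (borelSubgroup N).comap (MulAut.conj g).toMonoidHom :=
  Iff.rfl

theorem conjugators_closure {N : ℕ} (S : Set (GL2 N)) :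
    conjugators (Subgroup.closure S : Set (GL2 N)) = conjugators S := by
  ext g
  rw [mem_conjugators_iff, mem_conjugators_iff, SetLike.coe_subset_coe, Subgroup.closure_le]

theorem card_conjugators_map {N : ℕ} (R : Subgroup (GL2 N)) (h : GL2 N) :
    Nat.card (conjugators (R.map (MulAut.conj h).toMonoidHom : Set (GL2 N))) =
      Nat.card (conjugators (R : Set (GL2 N))) := by
  refine Nat.card_congr ((Equiv.mulRight h).subtypeEquiv fun g => ?_)
  simp [conjugators, mul_assoc]

/-- Every matrix is uniquely a Borel matrix times a standard representative of its bottom row. -/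
theorem card_conjugators {N : ℕ} [IsLocalRing (ZMod N)] [NeZero N] (S : Set (GL2 N)) :
    Nat.card (conjugators S) = numFixed S * Nat.card (B0 N) := by
  let F : (affineFixed S ⊕ {y | ¬ IsUnit y ∧ y ∈ oppositeFixed S}) × B0 N → conjugators S :=
    fun p => ⟨p.2.1 * Sum.elim (fun x => lowerUnipotent x.1) (fun y => swapUnipotent y.1) p.1, by
      refine (borel_mul_mem_conjugators p.2.2).2 ?_
      rcases p.1 with x | y
      · exact lowerUnipotent_mem_conjugators.2 x.2
      · exact swapUnipotent_mem_conjugators.2 y.2.2⟩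
  have hF : Function.Bijective F := by
    constructor
    · rintro ⟨p, b, hb⟩ ⟨p', b', hb'⟩ h
      have h := congrArg Subtype.val h
      simp only [F] at h
      have hp : p = p' := by
        have h0 := congrArg (fun g : GL2 N => g 1 0) h
        have h1 := congrArg (fun g : GL2 N => g 1 1) h
        have hb : b 1 0 = 0 := hb
        have hb' : b' 1 0 = 0 := hb'
        have hu : ∀ c : GL2 N, c 1 0 = 0 → IsUnit (c 1 1) := by
          intro c hc
          have := (Matrix.isUnit_iff_isUnit_det _).1 c.isUnit
          rw [Matrix.det_fin_two, hc] at this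
          simp only [mul_zero, sub_zero] at this
          exact isUnit_of_mul_isUnit_right this
        have ub := hu b hb
        have ub' := hu b' hb'
        rcases p with ⟨x, hx⟩ | ⟨y, hy⟩ <;> rcases p' with ⟨x', hx'⟩ | ⟨y', hy'⟩ <;>
          simp [lowerUnipotent, swapUnipotent, Matrix.mul_apply, Fin.sum_univ_two, hb, hb'] at h0 h1
        · rw [h1] at h0
          congr
          exact ub'.mul_left_cancel h0
        · exact absurd (isUnit_of_mul_isUnit_right (h1 ▸ ub)) hy'.1
        · exact absurd (isUnit_of_mul_isUnit_right (h1 ▸ ub')) hy.1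
        · rw [h0] at h1
          congr
          exact ub'.mul_left_cancel h1
      subst hp
      simpa using h
    · rintro ⟨g, hg⟩
      have hdet := (Matrix.isUnit_iff_isUnit_det _).1 g.isUnit
      rw [Matrix.det_fin_two] at hdet
      by_cases hd : IsUnit (g 1 1)
      · obtain ⟨v, hv⟩ := hd.exists_right_inv
        let x : ZMod N := g 1 0 * v
        have hb : g * (lowerUnipotent x)⁻¹ ∈ borelSubgroup N := by
          change (g * (lowerUnipotent x)⁻¹ : GL2 N) 1 0 = 0
          simp only [lowerUnipotent, Units.val_mul, ← Units.inv_eq_val_inv, Matrix.mul_apply,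
            Fin.sum_univ_two]
          simp only [of_apply, cons_val', cons_val_zero, cons_val_one, cons_val_fin_one]
          linear_combination (-(g 1 0)) * hv
        have hmem : x ∈ affineFixed S := by
          rw [← lowerUnipotent_mem_conjugators, ← borel_mul_mem_conjugators hb]
          simpa using hg
        exact ⟨(Sum.inl ⟨x, hmem⟩, ⟨_, hb⟩),
          Subtype.ext (inv_mul_cancel_right _ _)⟩
      · have hc : IsUnit (g 1 0) := by
          by_contra hc
          exact IsLocalRing.nonunits_add (a := g 0 0 * g 1 1) (b := - (g 0 1 * g 1 0))
            (fun h => hd (isUnit_of_mul_isUnit_right h))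
            (fun h => hc (isUnit_of_mul_isUnit_right (IsUnit.neg_iff _ |>.1 h)))
            (by rwa [← sub_eq_add_neg])
        obtain ⟨v, hv⟩ := hc.exists_right_inv
        let y : ZMod N := g 1 1 * v
        have hb : g * (swapUnipotent y)⁻¹ ∈ borelSubgroup N := by
          change (g * (swapUnipotent y)⁻¹ : GL2 N) 1 0 = 0
          simp only [swapUnipotent, Units.val_mul, ← Units.inv_eq_val_inv, Matrix.mul_apply,
            Fin.sum_univ_two]
          simp only [of_apply, cons_val', cons_val_zero, cons_val_one, cons_val_fin_one]
          linear_combination (-(g 1 1)) * hv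
        have hmem : y ∈ oppositeFixed S := by
          rw [← swapUnipotent_mem_conjugators, ← borel_mul_mem_conjugators hb]
          simpa using hg
        exact ⟨(Sum.inr ⟨y, fun h => hd (isUnit_of_mul_isUnit_left h), hmem⟩, ⟨_, hb⟩),
          Subtype.ext (inv_mul_cancel_right _ _)⟩
  rw [← Nat.card_congr (Equiv.ofBijective F hF), Nat.card_prod, Nat.card_sum, numFixed]

theorem mem_Sset_iff {N : ℕ} [IsLocalRing (ZMod N)] [NeZero N] (m : ℕ) :
    m ∈ Sset (B0 N) ↔ ∃ R : Subgroup (GL2 N), numFixed (R : Set (GL2 N)) = m := by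
  have hpos : 0 < Nat.card (B0 N) := Nat.card_pos (α := borelSubgroup N)
  refine exists_congr fun R => ?_
  change Nat.card (conjugators (R : Set (GL2 N))) = _ ↔ _
  rw [card_conjugators, Nat.mul_left_inj hpos.ne']

theorem numFixed_mem_Sset {N : ℕ} [IsLocalRing (ZMod N)] [NeZero N] (S : Set (GL2 N)) :
    numFixed S ∈ Sset (B0 N) :=
  ⟨Subgroup.closure S, by
    rw [← card_conjugators, ← conjugators_closure]; rfl⟩

theorem numFixed_map {N : ℕ} [IsLocalRing (ZMod N)] [NeZero N] (R : Subgroup (GL2 N))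
    (h : GL2 N) :
    numFixed (R.map (MulAut.conj h).toMonoidHom : Set (GL2 N)) =
      numFixed (R : Set (GL2 N)) := by
  have hpos : 0 < Nat.card (B0 N) := Nat.card_pos (α := borelSubgroup N)
  have := card_conjugators_map R h
  rwa [card_conjugators, card_conjugators, Nat.mul_left_inj hpos.ne'] at this

theorem zmod_two_pow_isLocalRing {k : ℕ} (hk : k ≠ 0) : IsLocalRing (ZMod (2 ^ k)) :=
  have : Fact (1 < 2 ^ k) := ⟨Nat.one_lt_two_pow hk⟩
  IsLocalRing.of_surjective' (PadicInt.toZModPow (p := 2) k) (ZMod.ringHom_surjective _)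

theorem zmod_two_pow_dvd_total {k : ℕ} (x y : ZMod (2 ^ k)) : x ∣ y ∨ y ∣ x := by
  obtain ⟨a, rfl⟩ := ZMod.ringHom_surjective (PadicInt.toZModPow (p := 2) k) x
  obtain ⟨b, rfl⟩ := ZMod.ringHom_surjective (PadicInt.toZModPow (p := 2) k) y
  exact (ValuationRing.dvd_total a b).imp (map_dvd _) (map_dvd _)

theorem card_addSubgroup_zmod_two_pow {k : ℕ} (A : AddSubgroup (ZMod (2 ^ k))) :
    ∃ i ≤ k, Nat.card A = 2 ^ i := by
  rw [← Nat.dvd_prime_pow Nat.prime_two]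
  simpa using A.card_addSubgroup_dvd_card

/-- The common zeros of quadratic polynomials `e x - b x ^ 2` over `ZMod (2 ^ k)` form one coset
or two cosets of an additive subgroup. -/
theorem card_common_zeros_eq_two_pow {k : ℕ} (hk : k ≠ 0) {ι : Type*} (S : Set ι)
    (b e : ι → ZMod (2 ^ k)) :
    ∃ i, Nat.card {x | ∀ r ∈ S, x * e r - b r * x ^ 2 = 0} = 2 ^ i := by
  have := zmod_two_pow_isLocalRing hk
  set X := {x | ∀ r ∈ S, x * e r - b r * x ^ 2 = 0} with hX
  have h0 : (0 : ZMod (2 ^ k)) ∈ X := by simp [hX]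
  obtain ⟨x₀, hx₀, hmax⟩ := Set.Finite.exists_maximalFor (fun x => Ideal.span {x}) X
    X.toFinite ⟨0, h0⟩
  have hdvd : ∀ x ∈ X, x₀ ∣ x := by
    intro x hx
    rcases zmod_two_pow_dvd_total x₀ x with h | h
    · exact h
    · exact Ideal.span_singleton_le_span_singleton.1
        (hmax hx (Ideal.span_singleton_le_span_singleton.2 h))
  let J : Ideal (ZMod (2 ^ k)) :=
    { carrier := {t | ∀ r ∈ S, t * (b r * x₀ ^ 2) = 0}
      zero_mem' := by simp
      add_mem' := fun {s t} hs ht r hr => by rw [add_mul, hs r hr, ht r hr, add_zero]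
      smul_mem' := fun c t ht r hr => by rw [smul_eq_mul, mul_assoc, ht r hr, mul_zero] }
  have hJ : ∀ t, x₀ * t ∈ X ↔ t * (t - 1) ∈ J := by
    intro t
    refine forall₂_congr fun r hr => ?_
    rw [← neg_eq_zero]
    refine Eq.congr_left ?_
    linear_combination (-t) * hx₀ r hr
  have hJ' : ∀ t, t * (t - 1) ∈ J ↔ t ∈ J ∨ t - 1 ∈ J := by
    refine fun t => ⟨fun h => ?_, fun h => h.elim (J.mul_mem_right _) (J.mul_mem_left _)⟩
    rcases IsLocalRing.isUnit_or_isUnit_one_sub_self t with hu | hu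
    · exact .inr ((J.unit_mul_mem_iff_mem hu).1 h)
    · rw [← IsUnit.neg_iff, neg_sub] at hu
      exact .inl ((J.mul_unit_mem_iff_mem hu).1 h)
  let A : AddSubgroup (ZMod (2 ^ k)) := J.toAddSubgroup.map (AddMonoidHom.mulLeft x₀)
  have hXA : X = (A : Set (ZMod (2 ^ k))) ∪ (x₀ + ·) '' A := by
    ext x
    constructor
    · intro hx
      obtain ⟨t, rfl⟩ := hdvd x hx
      rcases (hJ' t).1 ((hJ t).1 hx) with h | h
      · exact .inl ⟨t, h, rfl⟩
      · exact .inr ⟨_, ⟨t - 1, h, rfl⟩, by simp; ring⟩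
    · rintro (⟨t, ht, rfl⟩ | ⟨_, ⟨t, ht, rfl⟩, rfl⟩)
      · exact (hJ t).2 ((hJ' t).2 (.inl ht))
      · have : x₀ + x₀ * t = x₀ * (t + 1) := by ring
        simp only [AddMonoidHom.coe_mulLeft, this]
        exact (hJ _).2 ((hJ' _).2 (.inr (by simpa using ht)))
  obtain ⟨i, -, hi⟩ := card_addSubgroup_zmod_two_pow A
  by_cases hA : x₀ ∈ A
  · refine ⟨i, ?_⟩
    have : (x₀ + ·) '' (A : Set (ZMod (2 ^ k))) ⊆ A := by
      rintro _ ⟨a, ha, rfl⟩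
      exact A.add_mem hA ha
    rw [hXA, Set.union_eq_self_of_subset_right this]
    exact hi
  · refine ⟨i + 1, ?_⟩
    have hdisj : Disjoint (A : Set (ZMod (2 ^ k))) ((x₀ + ·) '' A) := by
      rw [Set.disjoint_right]
      rintro _ ⟨a, ha, rfl⟩ h
      exact hA ((A.add_mem_cancel_right ha).1 h)
    rw [hXA, Nat.card_coe_set_eq, Set.ncard_union_eq hdisj,
      Set.ncard_image_of_injective _ (add_right_injective x₀), ← Nat.card_coe_set_eq]
    change Nat.card A + Nat.card A = _
    rw [hi, pow_succ, mul_two]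

theorem card_nonunits_zmod_two_pow {k : ℕ} (hk : k ≠ 0) :
    Nat.card {y : ZMod (2 ^ k) | ¬ IsUnit y} = 2 ^ (k - 1) := by
  have h1 : Nat.card {y : ZMod (2 ^ k) | IsUnit y} = 2 ^ (k - 1) := by
    rw [show {y : ZMod (2 ^ k) | IsUnit y} = Set.range Units.val from rfl,
      Nat.card_congr (Equiv.ofInjective _ Units.val_injective).symm, Nat.card_eq_fintype_card,
      ZMod.card_units_eq_totient, Nat.totient_prime_pow Nat.prime_two (Nat.pos_of_ne_zero hk)]
    simp
  have h2 := Set.ncard_add_ncard_compl {y : ZMod (2 ^ k) | IsUnit y}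
  rw [← Nat.card_coe_set_eq, ← Nat.card_coe_set_eq, h1, Nat.card_zmod] at h2
  change 2 ^ (k - 1) + Nat.card {y : ZMod (2 ^ k) | ¬ IsUnit y} = _ at h2
  have : 2 ^ k = 2 ^ (k - 1) * 2 := by rw [← pow_succ, Nat.sub_add_cancel (Nat.pos_of_ne_zero hk)]
  omega

/-- The common annihilator of the differences of the diagonal entries of members of `S`. -/
def diagAnnihilator {N : ℕ} (S : Set (GL2 N)) : Ideal (ZMod N) where
  carrier := {x | ∀ r ∈ S, x * (r 0 0 - r 1 1) = 0}
  zero_mem' := by simp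
  add_mem' := fun {s t} hs ht r hr => by rw [add_mul, hs r hr, ht r hr, add_zero]
  smul_mem' := fun c t ht r hr => by rw [smul_eq_mul, mul_assoc, ht r hr, mul_zero]

theorem numFixed_of_diagonal {N : ℕ} {S : Set (GL2 N)}
    (hS : ∀ r ∈ S, r 0 1 = 0 ∧ r 1 0 = 0) :
    numFixed S = Nat.card (diagAnnihilator S) +
      Nat.card {y | ¬ IsUnit y ∧ y ∈ diagAnnihilator S} := by
  have h1 : affineFixed S = diagAnnihilator S := by
    ext x
    refine forall₂_congr fun r hr => ?_
    simp [hS r hr]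
  have h2 : oppositeFixed S = diagAnnihilator S := by
    ext x
    refine forall₂_congr fun r hr => ?_
    rw [← neg_eq_zero]
    refine Eq.congr_left ?_
    rw [(hS r hr).1, (hS r hr).2]
    ring
  rw [numFixed, h1, h2]
  rfl

theorem numFixed_of_diagonal_of_eq_top {k : ℕ} (hk : k ≠ 0) {S : Set (GL2 (2 ^ k))}
    (hS : ∀ r ∈ S, r 0 1 = 0 ∧ r 1 0 = 0) (hJ : diagAnnihilator S = ⊤) :
    numFixed S = 2 ^ k + 2 ^ (k - 1) := by
  rw [numFixed_of_diagonal hS, hJ]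
  simpa using card_nonunits_zmod_two_pow hk

theorem numFixed_of_diagonal_of_ne_top {N : ℕ} {S : Set (GL2 N)}
    (hS : ∀ r ∈ S, r 0 1 = 0 ∧ r 1 0 = 0) (hJ : diagAnnihilator S ≠ ⊤) :
    numFixed S = Nat.card (diagAnnihilator S) * 2 := by
  have : {y | ¬ IsUnit y ∧ y ∈ diagAnnihilator S} = diagAnnihilator S :=
    Set.ext fun y => and_iff_right_of_imp fun hy hu => hJ (Ideal.eq_top_of_isUnit_mem _ hy hu)
  rw [numFixed_of_diagonal hS, this, mul_two]
  rfl

theorem two_dvd_or_two_dvd_sub_one {k : ℕ} (x : ZMod (2 ^ k)) : 2 ∣ x ∨ 2 ∣ x - 1 := by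
  rw [← ZMod.natCast_zmod_val x]
  obtain ⟨c, hc | hc⟩ := Nat.even_or_odd' x.val
  · exact .inl ⟨c, by simp [hc]⟩
  · exact .inr ⟨c, by simp [hc]⟩

theorem isNilpotent_two_zmod_two_pow (k : ℕ) : IsNilpotent (2 : ZMod (2 ^ k)) :=
  ⟨k, mod_cast ZMod.natCast_self (2 ^ k)⟩

theorem two_dvd_iff_not_isUnit {k : ℕ} (hk : k ≠ 0) (x : ZMod (2 ^ k)) : 2 ∣ x ↔ ¬ IsUnit x := by
  have : Fact (1 < 2 ^ k) := ⟨Nat.one_lt_two_pow hk⟩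
  have hnil : ∀ c : ZMod (2 ^ k), IsNilpotent (2 * c) := fun c =>
    (Commute.all _ c).isNilpotent_mul_right (isNilpotent_two_zmod_two_pow k)
  constructor
  · rintro ⟨c, rfl⟩ hu
    exact (hnil c).not_isUnit hu
  · intro hx
    refine (two_dvd_or_two_dvd_sub_one x).resolve_right ?_
    rintro ⟨c, hc⟩
    rw [sub_eq_iff_eq_add'] at hc
    exact hx (hc ▸ (hnil c).isUnit_one_add)

theorem two_pow_pred_mul_two {k : ℕ} (hk : k ≠ 0) : (2 : ZMod (2 ^ k)) ^ (k - 1) * 2 = 0 := by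
  rw [pow_sub_one_mul hk]
  exact mod_cast ZMod.natCast_self (2 ^ k)

theorem two_pow_pred_ne_zero {k : ℕ} (hk : k ≠ 0) : (2 : ZMod (2 ^ k)) ^ (k - 1) ≠ 0 := by
  intro h
  have h : ((2 ^ (k - 1) : ℕ) : ZMod (2 ^ k)) = 0 := mod_cast h
  rw [ZMod.natCast_eq_zero_iff, Nat.pow_dvd_pow_iff_le_right'] at h
  omega

theorem numFixed_of_upperTriangular {k : ℕ} (hk : 2 ≤ k) {R : Subgroup (GL2 (2 ^ k))}
    (hR : ∀ r ∈ R, r 1 0 = 0) :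
    numFixed (R : Set (GL2 (2 ^ k))) ∈
      {m | ∃ i, 1 ≤ i ∧ i ≤ k ∧ m = 2 ^ i} ∪ {2 ^ k + 2 ^ (k - 1)} := by
  have hk0 : k ≠ 0 := by omega
  have := zmod_two_pow_isLocalRing hk0
  by_cases hy : ∃ y, y ∈ oppositeFixed (R : Set (GL2 (2 ^ k)))
  · obtain ⟨y, hy⟩ := hy
    rw [← numFixed_map R (upperUnipotent y)]
    have hdiag : ∀ r ∈ (R.map (MulAut.conj (upperUnipotent y)).toMonoidHom : Set (GL2 (2 ^ k))),
        r 0 1 = 0 ∧ r 1 0 = 0 := by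
      rintro _ ⟨r, hr, rfl⟩
      have h := hy r hr
      have h' := hR r hr
      simp only [MulEquiv.coe_toMonoidHom, MulAut.conj_apply, upperUnipotent, Units.val_mul,
        ← Units.inv_eq_val_inv, Matrix.mul_apply, Fin.sum_univ_two]
      simp only [of_apply, cons_val', cons_val_zero, cons_val_one, cons_val_fin_one]
      constructor
      · linear_combination h
      · linear_combination h'
    by_cases hJ : diagAnnihilator
        (R.map (MulAut.conj (upperUnipotent y)).toMonoidHom : Set (GL2 (2 ^ k))) = ⊤
    · exact .inr (numFixed_of_diagonal_of_eq_top hk0 hdiag hJ)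
    · rw [numFixed_of_diagonal_of_ne_top hdiag hJ]
      obtain ⟨i, hik, hi⟩ := card_addSubgroup_zmod_two_pow (diagAnnihilator
        (R.map (MulAut.conj (upperUnipotent y)).toMonoidHom : Set (GL2 (2 ^ k)))).toAddSubgroup
      refine .inl ⟨i + 1, by omega, ?_, ?_⟩
      · refine Nat.lt_of_le_of_ne hik ?_
        rintro rfl
        exact hJ (Submodule.toAddSubgroup_injective
          (AddSubgroup.eq_top_of_card_eq _ (by rw [hi, Nat.card_zmod])))
      · rw [pow_succ, ← hi]
        rfl
  · have hempty : {y | ¬ IsUnit y ∧ y ∈ oppositeFixed (R : Set (GL2 (2 ^ k)))} = ∅ :=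
      Set.eq_empty_of_forall_notMem fun y h => hy ⟨y, h.2⟩
    have haff : affineFixed (R : Set (GL2 (2 ^ k))) =
        {x | ∀ r ∈ (R : Set (GL2 (2 ^ k))), x * (r 0 0 - r 1 1) - r 0 1 * x ^ 2 = 0} := by
      ext x
      refine forall₂_congr fun r hr => ?_
      rw [hR r hr, zero_add]
    have hcard : numFixed (R : Set (GL2 (2 ^ k))) =
        Nat.card (affineFixed (R : Set (GL2 (2 ^ k)))) := by
      rw [numFixed, hempty]
      simp
    obtain ⟨i, hi⟩ := card_common_zeros_eq_two_pow hk0 (R : Set (GL2 (2 ^ k)))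
      (fun r => r 0 1) (fun r => r 0 0 - r 1 1)
    rw [← haff] at hi
    rw [hcard]
    refine .inl ⟨i, ?_, ?_, hi⟩
    · rw [Nat.one_le_iff_ne_zero]
      rintro rfl
      have h0 : 0 ∈ affineFixed (R : Set (GL2 (2 ^ k))) := by
        rw [haff]
        simp
      have h1 : 2 ^ (k - 1) ∈ affineFixed (R : Set (GL2 (2 ^ k))) := by
        rw [haff]
        intro r hr
        have hu : IsUnit (r 0 0 * r 1 1) := by
          have := (Matrix.isUnit_iff_isUnit_det _).1 r.isUnit
          rwa [Matrix.det_fin_two, hR r hr, mul_zero, sub_zero] at this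
        have hodd : ∀ u : ZMod (2 ^ k), IsUnit u → 2 ∣ u - 1 := fun u hu =>
          (two_dvd_or_two_dvd_sub_one u).resolve_left
            fun h => (two_dvd_iff_not_isUnit hk0 u).1 h hu
        obtain ⟨c, hc⟩ := hodd _ (isUnit_of_mul_isUnit_left hu)
        obtain ⟨d, hd⟩ := hodd _ (isUnit_of_mul_isUnit_right hu)
        have h2 := two_pow_pred_mul_two hk0
        have h3 : (2 : ZMod (2 ^ k)) ^ (k - 1) = 2 ^ (k - 2) * 2 := by
          rw [← pow_succ]
          congr 1
          omega
        linear_combination 2 ^ (k - 1) * hc - 2 ^ (k - 1) * hd + (c - d) * h2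
          - r 0 1 * 2 ^ (k - 1) * h3 - r 0 1 * 2 ^ (k - 2) * h2
      have hsub := (Nat.card_eq_one_iff_unique.1 hi).1
      exact two_pow_pred_ne_zero hk0 (Set.subsingleton_coe _ |>.1 hsub h1 h0)
    · rw [← Nat.pow_le_pow_iff_right one_lt_two, ← hi]
      simpa using Nat.card_le_card_of_injective _ (Subtype.val_injective
        (p := (· ∈ affineFixed (R : Set (GL2 (2 ^ k))))))

theorem card_mul_two_pow_eq_zero {k j : ℕ} (hj : j ≤ k) :
    Nat.card {x : ZMod (2 ^ k) | x * 2 ^ j = 0} = 2 ^ j := by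
  have h := IsAddCyclic.card_nsmulAddMonoidHom_ker (ZMod (2 ^ k)) (2 ^ j)
  rw [Nat.card_zmod, Nat.gcd_eq_right (pow_dvd_pow 2 hj)] at h
  rw [← h]
  refine Nat.card_congr (Equiv.subtypeEquivRight fun x => ?_)
  simp [AddMonoidHom.mem_ker, mul_comm]

theorem two_mem_Sset {k : ℕ} (hk : 2 ≤ k) : 2 ∈ Sset (B0 (2 ^ k)) := by
  have hk0 : k ≠ 0 := by omega
  have := zmod_two_pow_isLocalRing hk0
  convert numFixed_mem_Sset {upperUnipotent (1 : ZMod (2 ^ k)), diagOne (-1)} using 1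
  have h1 : affineFixed {upperUnipotent (1 : ZMod (2 ^ k)), diagOne (-1)} =
      {x | x * 2 ^ 1 = 0} := by
    ext x
    have h : x * 2 = 0 → x ^ 2 = 0 := by
      intro hx
      have hxu : 2 ∣ x := (two_dvd_iff_not_isUnit hk0 x).2 fun hu => by
        have h2 : (2 : ZMod (2 ^ k)) = 0 := hu.mul_right_eq_zero.1 hx
        apply two_pow_pred_ne_zero hk0
        rw [h2, zero_pow (by omega)]
      obtain ⟨c, rfl⟩ := hxu
      linear_combination c * hx
    simp [affineFixed, upperUnipotent, diagOne, one_add_one_eq_two]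
    exact h
  have h2 : oppositeFixed {upperUnipotent (1 : ZMod (2 ^ k)), diagOne (-1)} = ∅ := by
    simp [oppositeFixed, upperUnipotent]
  rw [numFixed, h1, h2, card_mul_two_pow_eq_zero (by omega)]
  simp

theorem two_pow_mem_Sset {k i : ℕ} (hi : i ≠ 0) (hik : i < k) :
    2 ^ (i + 1) ∈ Sset (B0 (2 ^ k)) := by
  have hk0 : k ≠ 0 := by omega
  have := zmod_two_pow_isLocalRing hk0
  obtain ⟨u, hu⟩ := ((isNilpotent_two_zmod_two_pow k).pow_of_pos hi).isUnit_one_add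
  have hJ : (diagAnnihilator {diagOne u} : Set (ZMod (2 ^ k))) = {x | x * 2 ^ i = 0} := by
    ext x
    simp [diagAnnihilator, diagOne, hu]
  have hcard : Nat.card (diagAnnihilator {diagOne u}) = 2 ^ i := by
    rw [← card_mul_two_pow_eq_zero hik.le, ← hJ]
    rfl
  have htop : diagAnnihilator {diagOne u} ≠ ⊤ := by
    intro h
    rw [h, Nat.card_congr Submodule.topEquiv.toEquiv, Nat.card_zmod] at hcard
    exact hik.ne' (Nat.pow_right_injective le_rfl hcard)
  rw [pow_succ, ← hcard, ← numFixed_of_diagonal_of_ne_top (by simp [diagOne]) htop]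
  exact numFixed_mem_Sset _

theorem zero_mem_Sset {N : ℕ} (hN : 1 < N) : 0 ∈ Sset (B0 N) := by
  have : Fact (1 < N) := ⟨hN⟩
  refine ⟨⊤, ?_⟩
  rw [zero_mul, conjCount, Nat.card_eq_zero]
  refine .inl (Set.isEmpty_coe_sort.2 (Set.eq_empty_of_forall_notMem fun g hg => ?_))
  have h := hg (g⁻¹ * swapUnipotent 0 * g) trivial
  simp [B0, mul_assoc, swapUnipotent] at h

theorem two_pow_add_two_pow_pred_mem_Sset {k : ℕ} (hk : k ≠ 0) :
    2 ^ k + 2 ^ (k - 1) ∈ Sset (B0 (2 ^ k)) := by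
  have := zmod_two_pow_isLocalRing hk
  rw [← numFixed_of_diagonal_of_eq_top hk (S := ∅) (by simp)
    ((Ideal.eq_top_iff_one _).2 (by simp [diagAnnihilator]))]
  exact numFixed_mem_Sset _

theorem S_B0_two_pow (k : ℕ) (hk : 2 ≤ k) :
    Sset (B0 (2 ^ k)) =
      {0} ∪ {m | ∃ i, 1 ≤ i ∧ i ≤ k ∧ m = 2 ^ i} ∪ {2 ^ k + 2 ^ (k - 1)} := by
  have hk0 : k ≠ 0 := by omega
  have := zmod_two_pow_isLocalRing hk0
  rw [Set.union_assoc]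
  ext m
  constructor
  · intro hm
    obtain ⟨R, rfl⟩ := (mem_Sset_iff m).1 hm
    rcases (conjugators (R : Set (GL2 (2 ^ k)))).eq_empty_or_nonempty with h | ⟨g, hg⟩
    · left
      have hpos : 0 < Nat.card (B0 (2 ^ k)) := Nat.card_pos (α := borelSubgroup (2 ^ k))
      have := card_conjugators (R : Set (GL2 (2 ^ k)))
      rw [h, Nat.card_of_isEmpty] at this
      exact (Nat.mul_eq_zero.1 this.symm).resolve_right hpos.ne'
    · right
      rw [← numFixed_map R g]
      refine numFixed_of_upperTriangular hk ?_
      rintro _ ⟨r, hr, rfl⟩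
      exact hg r hr
  · rintro (rfl | ⟨i, hi, hik, rfl⟩ | rfl)
    · exact zero_mem_Sset (Nat.one_lt_two_pow hk0)
    · obtain rfl | hi1 := hi.eq_or_lt
      · exact two_mem_Sset hk
      · obtain ⟨j, rfl⟩ := Nat.exists_eq_add_of_lt hi
        exact two_pow_mem_Sset (by omega) (by omega)
    · exact two_pow_add_two_pow_pred_mem_Sset hk0
end

section
/- Let p be an odd prime and k a positive integer. Then: (i) for every subgroup R of GL₂(ℤ/p^{k+1}ℤ) with c_k(π(R)) = p^k + p^{k-1}, one has c_{k+1}(R) ∈ {0, p^k, 2p^k, p^{k+1} + p^k}, and conversely each of the four values 0, p^k, 2p^k, p^{k+1} + p^k equals c_{k+1}(R) for some subgroup R with c_k(π(R)) = p^k + p^{k-1}; (ii) for every subgroup R of GL₂(ℤ/p^{k+1}ℤ) with c_k(π(R)) = 0, one has c_{k+1}(R) = 0. -/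
open Matrix

/-- Reduction `GL₂(ℤ/p^{k+1}ℤ) →* GL₂(ℤ/p^kℤ)` induced by reduction of entries mod `p^k`. -/
def redGL (p k : ℕ) : GL2 (p ^ (k + 1)) →* GL2 (p ^ k) :=
  Units.map ((ZMod.castHom (pow_dvd_pow p (Nat.le_succ k)) (ZMod (p ^ k))).mapMatrix.toMonoidHom)

namespace GL2Borel

/-- The Borel subgroup as a `Subgroup`. -/
def borel (N : ℕ) : Subgroup (GL2 N) where
  carrier := B0 N
  one_mem' := by simp [B0]
  mul_mem' := by
    intro a b ha hb
    simp only [B0, Set.mem_ofPred_eq] at ha hb ⊢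
    simp [Matrix.mul_apply, Fin.sum_univ_two, ha, hb]
  inv_mem' := by
    intro a ha
    simp only [B0, Set.mem_ofPred_eq] at ha ⊢
    simp [Matrix.inv_def, Matrix.adjugate_fin_two, ha]

lemma conj_mem_B0_iff {N : ℕ} (g r : GL2 N) :
    g * r * g⁻¹ ∈ B0 N ↔
      r.1 1 0 * g.1 1 1 ^ 2 + (r.1 0 0 - r.1 1 1) * (g.1 1 0 * g.1 1 1)
        - r.1 0 1 * g.1 1 0 ^ 2 = 0 := by
  have hu : IsUnit (Ring.inverse g.1.det) :=
    ((Matrix.isUnit_iff_isUnit_det _).1 g.isUnit).ringInverse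
  rw [← hu.mul_right_eq_zero]
  simp only [B0, Set.mem_ofPred_eq, Units.val_mul, Matrix.coe_units_inv, Matrix.inv_def,
    Matrix.adjugate_fin_two]
  simp only [Matrix.mul_apply, Fin.sum_univ_two, Matrix.smul_apply, smul_eq_mul, Matrix.of_apply,
    Matrix.cons_val', Matrix.cons_val_zero, Matrix.cons_val_one, Matrix.cons_val_fin_one]
  constructor <;> intro h <;> linear_combination h

lemma conj_closure_iff {N : ℕ} (S : Set (GL2 N)) (g : GL2 N) :
    (∀ r ∈ Subgroup.closure S, g * r * g⁻¹ ∈ B0 N) ↔ ∀ r ∈ S, g * r * g⁻¹ ∈ B0 N := by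
  have h := Subgroup.closure_le (k := S) ((borel N).comap (MulAut.conj g).toMonoidHom)
  exact h

/-- The lower unipotent matrix with lower-left entry `t`. -/
def lowerUnipotent {N : ℕ} (t : ZMod N) : GL2 N :=
  ⟨!![1, 0; t, 1], !![1, 0; -t, 1], by simp [Matrix.one_fin_two], by simp [Matrix.one_fin_two]⟩

/-- The matrix interchanging the two coordinates. -/
def swap (N : ℕ) : GL2 N :=
  ⟨!![0, 1; 1, 0], !![0, 1; 1, 0], by simp [Matrix.one_fin_two], by simp [Matrix.one_fin_two]⟩

lemma card_big_cell {N : ℕ} (T : Set (ZMod N)) :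
    Nat.card {g : GL2 N | IsUnit (g.1 1 1) ∧ ∃ t ∈ T, g.1 1 0 = g.1 1 1 * t} =
      Nat.card T * Nat.card (B0 N) := by
  rw [mul_comm, ← Nat.card_prod]
  symm
  have hB : ∀ b : GL2 N, b ∈ B0 N → IsUnit (b.1 1 1) := by
    intro b hb
    have h := (Matrix.isUnit_iff_isUnit_det _).1 b.isUnit
    have hb' : b.1 1 0 = 0 := hb
    rw [Matrix.det_fin_two, hb', mul_zero, sub_zero] at h
    exact isUnit_of_mul_isUnit_right h
  have h10 : ∀ (b : GL2 N) (t : ZMod N), b ∈ B0 N →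
      (b * lowerUnipotent t).1 1 0 = b.1 1 1 * t := by
    intro b t hb
    have hb' : b.1 1 0 = 0 := hb
    simp [lowerUnipotent, Matrix.mul_apply, Fin.sum_univ_two, hb']
  have h11 : ∀ (b : GL2 N) (t : ZMod N), (b * lowerUnipotent t).1 1 1 = b.1 1 1 := by
    intro b t
    simp [lowerUnipotent, Matrix.mul_apply, Fin.sum_univ_two]
  refine Nat.card_congr (Equiv.ofBijective
    (fun x => ⟨x.1.1 * lowerUnipotent x.2.1, ?_⟩) ⟨?_, ?_⟩)
  · refine ⟨?_, x.2.1, x.2.2, ?_⟩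
    · rw [h11]; exact hB _ x.1.2
    · rw [h11, h10 _ _ x.1.2]
  · rintro ⟨⟨b, hb⟩, ⟨t, ht⟩⟩ ⟨⟨b', hb'⟩, ⟨t', ht'⟩⟩ h
    have h : b * lowerUnipotent t = b' * lowerUnipotent t' := congrArg Subtype.val h
    have e1 := h11 b t
    have e0 := h10 b t hb
    rw [h, h11] at e1
    rw [h, h10 _ _ hb', e1] at e0
    have : t = t' := ((hB b hb).mul_left_cancel e0).symm
    subst this
    have := mul_right_cancel h
    subst this
    rfl
  · rintro ⟨g, hg, t, ht, hgt⟩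
    refine ⟨⟨⟨g * (lowerUnipotent t)⁻¹, ?_⟩, ⟨t, ht⟩⟩, ?_⟩
    · change (g.1 * (!![1, 0; -t, 1] : Matrix (Fin 2) (Fin 2) (ZMod N))) 1 0 = 0
      simp [Matrix.mul_apply, Fin.sum_univ_two, hgt]
    · simp

section PrimePower

variable (p k : ℕ)

/-- Reduction from `ℤ/p^{k+1}ℤ` to `ℤ/pℤ`. -/
def redP : ZMod (p ^ (k + 1)) →+* ZMod p :=
  ZMod.castHom (dvd_pow_self p (Nat.succ_ne_zero k)) (ZMod p)

variable [Fact p.Prime]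

lemma isUnit_iff_redP (a : ZMod (p ^ (k + 1))) : IsUnit a ↔ redP p k a ≠ 0 := by
  obtain ⟨n, rfl⟩ := ZMod.natCast_zmod_surjective a
  rw [ZMod.isUnit_iff_coprime, map_natCast, Ne, ZMod.natCast_eq_zero_iff,
    Nat.coprime_pow_right_iff (Nat.succ_pos k), Nat.coprime_comm,
    (Fact.out : p.Prime).coprime_iff_not_dvd]

lemma pow_mul_eq_zero_iff (a : ZMod (p ^ (k + 1))) :
    (p : ZMod (p ^ (k + 1))) ^ k * a = 0 ↔ redP p k a = 0 := by
  obtain ⟨n, rfl⟩ := ZMod.natCast_zmod_surjective a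
  rw [map_natCast, ZMod.natCast_eq_zero_iff, ← Nat.cast_pow, ← Nat.cast_mul,
    ZMod.natCast_eq_zero_iff, pow_succ,
    Nat.mul_dvd_mul_iff_left (pow_pos (Fact.out : p.Prime).pos k)]

lemma exists_eq_pow_mul {a : ZMod (p ^ (k + 1))}
    (h : ZMod.castHom (pow_dvd_pow p (Nat.le_succ k)) (ZMod (p ^ k)) a = 0) :
    ∃ b, a = (p : ZMod (p ^ (k + 1))) ^ k * b := by
  obtain ⟨n, rfl⟩ := ZMod.natCast_zmod_surjective a
  rw [map_natCast, ZMod.natCast_eq_zero_iff] at h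
  obtain ⟨m, rfl⟩ := h
  exact ⟨m, by push_cast; rfl⟩

lemma card_redP_eq_zero : Nat.card {t | redP p k t = 0} = p ^ k := by
  have h := AddSubgroup.card_mul_index (redP p k).toAddMonoidHom.ker
  have hs : Function.Surjective (redP p k) := ZMod.ringHom_surjective _
  rw [AddSubgroup.index_ker, AddMonoidHom.range_eq_top.2 hs, AddSubgroup.card_top,
    Nat.card_zmod p] at h
  exact Nat.eq_of_mul_eq_mul_right (Fact.out : p.Prime).pos
    (h.trans ((Nat.card_zmod _).trans (pow_succ p k)))

/-- The matrices that are upper triangular modulo `p`. -/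
def borelP : Subgroup (GL2 (p ^ (k + 1))) :=
  (borel p).comap (Matrix.GeneralLinearGroup.map (redP p k))

variable {p k}

lemma mem_borelP {g : GL2 (p ^ (k + 1))} : g ∈ borelP p k ↔ redP p k (g.1 1 0) = 0 :=
  Iff.rfl

lemma redP_det_ne_zero (g : GL2 (p ^ (k + 1))) :
    redP p k (g.1 0 0) * redP p k (g.1 1 1) - redP p k (g.1 0 1) * redP p k (g.1 1 0) ≠ 0 := by
  have h := (isUnit_iff_redP p k _).1 ((Matrix.isUnit_iff_isUnit_det _).1 g.isUnit)
  rwa [Matrix.det_fin_two, map_sub, map_mul, map_mul] at h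

lemma card_borelP :
    Nat.card (borelP p k : Set (GL2 (p ^ (k + 1)))) =
      p ^ k * Nat.card (B0 (p ^ (k + 1))) := by
  rw [← card_redP_eq_zero p k, ← card_big_cell]
  congr 2
  ext g
  simp only [SetLike.mem_coe, mem_borelP, Set.mem_ofPred_eq]
  constructor
  · intro h
    have hd := redP_det_ne_zero g
    rw [h] at hd
    have hu : IsUnit (g.1 1 1) := by
      rw [isUnit_iff_redP]
      intro h0
      simp [h0] at hd
    refine ⟨hu, Ring.inverse (g.1 1 1) * g.1 1 0, by simp [h], ?_⟩
    rw [← mul_assoc, Ring.mul_inverse_cancel _ hu, one_mul]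
  · rintro ⟨-, t, ht, h⟩
    simp [h, ht]

lemma card_coset (g₀ : GL2 (p ^ (k + 1))) :
    Nat.card {g | g * g₀⁻¹ ∈ borelP p k} = p ^ k * Nat.card (B0 (p ^ (k + 1))) := by
  rw [← card_borelP]
  exact Nat.card_congr ((Equiv.mulRight g₀⁻¹).subtypeEquiv fun g => Iff.rfl)

lemma mul_inv_mem_borelP (g g₀ : GL2 (p ^ (k + 1))) :
    g * g₀⁻¹ ∈ borelP p k ↔
      redP p k (g.1 1 0) * redP p k (g₀.1 1 1) - redP p k (g.1 1 1) * redP p k (g₀.1 1 0) = 0 := by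
  have hu : IsUnit (Ring.inverse g₀.1.det) :=
    ((Matrix.isUnit_iff_isUnit_det _).1 g₀.isUnit).ringInverse
  rw [← ((hu.map (redP p k))).mul_right_eq_zero]
  simp only [mem_borelP, Units.val_mul, Matrix.coe_units_inv, Matrix.inv_def,
    Matrix.adjugate_fin_two]
  simp only [Matrix.mul_apply, Fin.sum_univ_two, Matrix.smul_apply, smul_eq_mul, Matrix.of_apply,
    Matrix.cons_val', Matrix.cons_val_zero, Matrix.cons_val_one, Matrix.cons_val_fin_one,
    map_add, map_mul, map_neg]
  constructor <;> intro h <;> linear_combination h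

lemma card_two_cosets {g₀ g₁ : GL2 (p ^ (k + 1))} (h : g₁ * g₀⁻¹ ∉ borelP p k) :
    Nat.card {g | g * g₀⁻¹ ∈ borelP p k ∨ g * g₁⁻¹ ∈ borelP p k} =
      2 * p ^ k * Nat.card (B0 (p ^ (k + 1))) := by
  have hd : Disjoint {g | g * g₀⁻¹ ∈ borelP p k} {g | g * g₁⁻¹ ∈ borelP p k} := by
    rw [Set.disjoint_left]
    intro g hg hg'
    apply h
    have := (borelP p k).mul_mem ((borelP p k).inv_mem hg') hg
    simpa [mul_assoc] using this
  have := Set.ncard_union_eq hd (Set.toFinite _) (Set.toFinite _)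
  rw [← Nat.card_coe_set_eq, ← Nat.card_coe_set_eq, ← Nat.card_coe_set_eq,
    card_coset, card_coset] at this
  rw [mul_assoc, two_mul]
  exact this

variable (p k) in
lemma card_GL2 :
    Nat.card (GL2 (p ^ (k + 1))) = (p ^ (k + 1) + p ^ k) * Nat.card (B0 (p ^ (k + 1))) := by
  have hA := card_big_cell (N := p ^ (k + 1)) Set.univ
  have hB : Nat.card {g : GL2 (p ^ (k + 1)) | redP p k (g.1 1 1) = 0} = _ :=
    (Nat.card_congr (Equiv.setCongr (by
      ext g
      rw [Set.mem_ofPred_eq, Set.mem_ofPred_eq, mul_inv_mem_borelP]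
      simp [swap]))).trans (card_coset (swap (p ^ (k + 1))))
  have hAc : {g : GL2 (p ^ (k + 1)) |
      IsUnit (g.1 1 1) ∧ ∃ t ∈ Set.univ, g.1 1 0 = g.1 1 1 * t}ᶜ =
      {g | redP p k (g.1 1 1) = 0} := by
    ext g
    simp only [Set.mem_compl_iff, Set.mem_ofPred_eq, Set.mem_univ, true_and]
    rw [← not_iff_not, not_not, ← Ne, ← isUnit_iff_redP]
    refine ⟨fun h => h.1, fun h => ⟨h, Ring.inverse (g.1 1 1) * g.1 1 0, ?_⟩⟩
    rw [← mul_assoc, Ring.mul_inverse_cancel _ h, one_mul]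
  have := Set.ncard_add_ncard_compl {g : GL2 (p ^ (k + 1)) |
      IsUnit (g.1 1 1) ∧ ∃ t ∈ Set.univ, g.1 1 0 = g.1 1 1 * t}
  rw [hAc, ← Nat.card_coe_set_eq, ← Nat.card_coe_set_eq, hA, hB] at this
  rw [← this, Nat.card_univ, Nat.card_zmod, add_mul]

lemma conjCount_eq_full_iff (R : Subgroup (GL2 (p ^ (k + 1)))) :
    conjCount (B0 (p ^ (k + 1))) R = (p ^ (k + 1) + p ^ k) * Nat.card (B0 (p ^ (k + 1))) ↔
      ∀ r ∈ R, r.1 1 0 = 0 ∧ r.1 0 1 = 0 ∧ r.1 0 0 = r.1 1 1 := by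
  rw [← card_GL2, conjCount, Nat.card_coe_set_eq, ← Set.ncard_univ]
  constructor
  · intro h r hr
    have hS := Set.eq_of_subset_of_ncard_le (Set.subset_univ _) h.ge (Set.toFinite _)
    have hmem : ∀ g, g * r * g⁻¹ ∈ B0 (p ^ (k + 1)) := fun g => by
      have hg : g ∈ {g : GL2 (p ^ (k + 1)) | ∀ r ∈ R, g * r * g⁻¹ ∈ B0 (p ^ (k + 1))} :=
        hS ▸ Set.mem_univ g
      exact hg r hr
    have h1 := (conj_mem_B0_iff _ _).1 (hmem 1)
    have h2 := (conj_mem_B0_iff _ _).1 (hmem (swap _))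
    have h3 := (conj_mem_B0_iff _ _).1 (hmem (lowerUnipotent 1))
    simp [swap, lowerUnipotent] at h1 h2 h3
    refine ⟨h1, h2, ?_⟩
    rw [h1, h2] at h3
    linear_combination h3
  · intro h
    congr 1
    refine Set.eq_univ_of_forall fun g r hr => ?_
    obtain ⟨h1, h2, h3⟩ := h r hr
    rw [conj_mem_B0_iff, h1, h2, h3]
    ring

lemma mem_of_mul_inv_mem_borelP {x y z : ZMod p} {g g₀ : GL2 (p ^ (k + 1))}
    (h : g * g₀⁻¹ ∈ borelP p k)
    (h₀ : x * redP p k (g₀.1 1 1) ^ 2 + z * (redP p k (g₀.1 1 0) * redP p k (g₀.1 1 1))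
        - y * redP p k (g₀.1 1 0) ^ 2 = 0) :
    x * redP p k (g.1 1 1) ^ 2 + z * (redP p k (g.1 1 0) * redP p k (g.1 1 1))
        - y * redP p k (g.1 1 0) ^ 2 = 0 := by
  rw [mul_inv_mem_borelP] at h
  have hdet := redP_det_ne_zero g₀
  generalize redP p k (g.1 1 0) = c, redP p k (g.1 1 1) = d, redP p k (g₀.1 1 0) = c₀,
    redP p k (g₀.1 1 1) = d₀ at *
  by_cases hd : d₀ = 0
  · have hc : c₀ ≠ 0 := by
      rintro rfl
      simp [hd] at hdet
    refine (mul_eq_zero.1 ?_).resolve_left (pow_ne_zero 2 hc)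
    linear_combination c ^ 2 * h₀ - (x * (c * d₀ + d * c₀) + z * c * c₀) * h
  · refine (mul_eq_zero.1 ?_).resolve_left (pow_ne_zero 2 hd)
    linear_combination d ^ 2 * h₀ + (z * d * d₀ - y * (c * d₀ + d * c₀)) * h

lemma eq_zero_of_three_zeros {F : Type*} [Field F] {x y z c₀ d₀ c₁ d₁ c₂ d₂ : F}
    (h₀ : x * d₀ ^ 2 + z * (c₀ * d₀) - y * c₀ ^ 2 = 0)
    (h₁ : x * d₁ ^ 2 + z * (c₁ * d₁) - y * c₁ ^ 2 = 0)
    (h₂ : x * d₂ ^ 2 + z * (c₂ * d₂) - y * c₂ ^ 2 = 0)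
    (h₀₁ : c₁ * d₀ - d₁ * c₀ ≠ 0) (h₀₂ : c₂ * d₀ - d₂ * c₀ ≠ 0)
    (h₁₂ : c₂ * d₁ - d₂ * c₁ ≠ 0) : x = 0 ∧ y = 0 ∧ z = 0 := by
  have hD := mul_ne_zero (mul_ne_zero h₀₁ h₀₂) h₁₂
  refine ⟨(mul_eq_zero.1 ?_).resolve_left hD, (mul_eq_zero.1 ?_).resolve_left hD,
    (mul_eq_zero.1 ?_).resolve_left hD⟩
  · linear_combination c₁ * c₂ * (c₂ * d₁ - d₂ * c₁) * h₀ - c₀ * c₂ * (c₂ * d₀ - d₂ * c₀) * h₁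
      + c₀ * c₁ * (c₁ * d₀ - d₁ * c₀) * h₂
  · linear_combination -d₁ * d₂ * (c₂ * d₁ - d₂ * c₁) * h₀ + d₀ * d₂ * (c₂ * d₀ - d₂ * c₀) * h₁
      - d₀ * d₁ * (c₁ * d₀ - d₁ * c₀) * h₂
  · linear_combination -(d₁ * c₂ + c₁ * d₂) * (c₂ * d₁ - d₂ * c₁) * h₀
      + (d₀ * c₂ + c₀ * d₂) * (c₂ * d₀ - d₂ * c₀) * h₁
      - (d₀ * c₁ + c₀ * d₁) * (c₁ * d₀ - d₁ * c₀) * h₂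

/-- If `r` is scalar modulo `p ^ k`, then `g * r * g⁻¹` is upper triangular exactly when a certain
binary quadratic form over `ℤ/pℤ` vanishes at the bottom row of `g`. -/
lemma exists_coeff {r : GL2 (p ^ (k + 1))} (h10 : (redGL p k r).1 1 0 = 0)
    (h01 : (redGL p k r).1 0 1 = 0) (hd : (redGL p k r).1 0 0 = (redGL p k r).1 1 1) :
    ∃ x y z : ZMod p, ∀ g : GL2 (p ^ (k + 1)), g * r * g⁻¹ ∈ B0 (p ^ (k + 1)) ↔
      x * redP p k (g.1 1 1) ^ 2 + z * (redP p k (g.1 1 0) * redP p k (g.1 1 1))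
        - y * redP p k (g.1 1 0) ^ 2 = 0 := by
  obtain ⟨x, hx⟩ := exists_eq_pow_mul p k h10
  obtain ⟨y, hy⟩ := exists_eq_pow_mul p k h01
  obtain ⟨z, hz⟩ := exists_eq_pow_mul p k (a := r.1 0 0 - r.1 1 1)
    (by rw [map_sub, sub_eq_zero]; exact hd)
  refine ⟨redP p k x, redP p k y, redP p k z, fun g => ?_⟩
  rw [conj_mem_B0_iff, hx, hy, hz]
  simp only [← map_mul, ← map_pow, ← map_add, ← map_sub, ← pow_mul_eq_zero_iff]
  constructor <;> intro h <;> linear_combination h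

lemma card_of_scalar_mod (R : Subgroup (GL2 (p ^ (k + 1))))
    (hR : ∀ r ∈ R.map (redGL p k), r.1 1 0 = 0 ∧ r.1 0 1 = 0 ∧ r.1 0 0 = r.1 1 1) :
    ∃ m, (m = 0 ∨ m = p ^ k ∨ m = 2 * p ^ k ∨ m = p ^ (k + 1) + p ^ k) ∧
      conjCount (B0 (p ^ (k + 1))) R = m * Nat.card (B0 (p ^ (k + 1))) := by
  have hq := fun r (hr : r ∈ R) =>
    have h := hR _ (Subgroup.mem_map_of_mem (redGL p k) hr)
    exists_coeff h.1 h.2.1 h.2.2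
  unfold conjCount
  set S := {g : GL2 (p ^ (k + 1)) | ∀ r ∈ R, g * r * g⁻¹ ∈ B0 (p ^ (k + 1))} with hS
  have hcoset : ∀ g₀ ∈ S, ∀ g, g * g₀⁻¹ ∈ borelP p k → g ∈ S := by
    intro g₀ h₀ g hg r hr
    obtain ⟨x, y, z, h⟩ := hq r hr
    exact (h g).2 (mem_of_mul_inv_mem_borelP hg ((h g₀).1 (h₀ r hr)))
  by_cases hemp : S = ∅
  · exact ⟨0, by simp, by simp [hemp]⟩
  obtain ⟨g₀, h₀⟩ := Set.nonempty_iff_ne_empty.2 hemp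
  by_cases hone : ∀ g ∈ S, g * g₀⁻¹ ∈ borelP p k
  · refine ⟨p ^ k, by simp, ?_⟩
    rw [← card_coset g₀, show S = {g | g * g₀⁻¹ ∈ borelP p k} from
      Set.Subset.antisymm hone (hcoset g₀ h₀)]
  push Not at hone
  obtain ⟨g₁, h₁, h₀₁⟩ := hone
  by_cases htwo : ∀ g ∈ S, g * g₀⁻¹ ∈ borelP p k ∨ g * g₁⁻¹ ∈ borelP p k
  · refine ⟨2 * p ^ k, by simp, ?_⟩
    rw [← card_two_cosets h₀₁,
      show S = {g | g * g₀⁻¹ ∈ borelP p k ∨ g * g₁⁻¹ ∈ borelP p k} from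
        Set.Subset.antisymm htwo fun g hg => hg.elim (hcoset g₀ h₀ g) (hcoset g₁ h₁ g)]
  push Not at htwo
  obtain ⟨g₂, h₂, h₀₂, h₁₂⟩ := htwo
  refine ⟨p ^ (k + 1) + p ^ k, by simp, ?_⟩
  rw [← card_GL2, ← Nat.card_univ (α := GL2 (p ^ (k + 1)))]
  have : S = Set.univ := by
    refine Set.eq_univ_of_forall fun g r hr => ?_
    obtain ⟨x, y, z, h⟩ := hq r hr
    rw [mul_inv_mem_borelP] at h₀₁ h₀₂ h₁₂
    obtain ⟨rfl, rfl, rfl⟩ := eq_zero_of_three_zeros ((h g₀).1 (h₀ r hr)) ((h g₁).1 (h₁ r hr))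
      ((h g₂).1 (h₂ r hr)) h₀₁ h₀₂ h₁₂
    rw [h]
    ring
  rw [this]

lemma pow_mul_pow_eq_zero (hk : 0 < k) :
    (p : ZMod (p ^ (k + 1))) ^ k * (p : ZMod (p ^ (k + 1))) ^ k = 0 := by
  rw [pow_mul_eq_zero_iff, map_pow, map_natCast, ZMod.natCast_self, zero_pow hk.ne']

variable (p) in
/-- The matrix `1 + p ^ k • X`, an element of the kernel of reduction modulo `p ^ k`. -/
def kernelElement (hk : 0 < k) (X : Matrix (Fin 2) (Fin 2) (ZMod (p ^ (k + 1)))) :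
    GL2 (p ^ (k + 1)) :=
  ⟨1 + (p : ZMod (p ^ (k + 1))) ^ k • X, 1 - (p : ZMod (p ^ (k + 1))) ^ k • X,
    by simp [add_mul, mul_sub, smul_smul, pow_mul_pow_eq_zero hk],
    by simp [sub_mul, mul_add, smul_sub, smul_smul, pow_mul_pow_eq_zero hk]⟩

lemma redGL_kernelElement (hk : 0 < k) (X : Matrix (Fin 2) (Fin 2) (ZMod (p ^ (k + 1)))) :
    redGL p k (kernelElement p hk X) = 1 := by
  have hp : ZMod.castHom (pow_dvd_pow p (Nat.le_succ k)) (ZMod (p ^ k))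
      ((p : ZMod (p ^ (k + 1))) ^ k) = 0 := by
    rw [map_pow, map_natCast, ← Nat.cast_pow, ZMod.natCast_self]
  ext i j
  change ZMod.castHom (pow_dvd_pow p (Nat.le_succ k)) (ZMod (p ^ k))
    ((1 + (p : ZMod (p ^ (k + 1))) ^ k • X) i j) = (1 : Matrix (Fin 2) (Fin 2) (ZMod (p ^ k))) i j
  rw [Matrix.add_apply, Matrix.smul_apply, smul_eq_mul, map_add, map_mul, hp, zero_mul, add_zero,
    Matrix.one_apply, Matrix.one_apply]
  split_ifs
  · exact map_one _
  · exact map_zero _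

lemma conj_kernelElement_mem_iff (hk : 0 < k) (X : Matrix (Fin 2) (Fin 2) (ZMod (p ^ (k + 1))))
    (g : GL2 (p ^ (k + 1))) :
    g * kernelElement p hk X * g⁻¹ ∈ B0 (p ^ (k + 1)) ↔
      redP p k (X 1 0 * g.1 1 1 ^ 2 + (X 0 0 - X 1 1) * (g.1 1 0 * g.1 1 1)
        - X 0 1 * g.1 1 0 ^ 2) = 0 := by
  rw [conj_mem_B0_iff, ← pow_mul_eq_zero_iff]
  simp only [kernelElement, Matrix.add_apply, Matrix.smul_apply, smul_eq_mul, Matrix.one_apply_eq,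
    ne_eq, one_ne_zero, zero_ne_one, not_false_eq_true, Matrix.one_apply_ne]
  constructor <;> intro h <;> linear_combination h

lemma map_closure_kernelElement (hk : 0 < k)
    (A : Set (Matrix (Fin 2) (Fin 2) (ZMod (p ^ (k + 1))))) :
    (Subgroup.closure (kernelElement p hk '' A)).map (redGL p k) = ⊥ := by
  rw [eq_bot_iff, Subgroup.map_le_iff_le_comap, Subgroup.closure_le]
  rintro _ ⟨X, -, rfl⟩
  exact redGL_kernelElement hk X

lemma conjCount_closure_kernelElement (hk : 0 < k)
    (A : Set (Matrix (Fin 2) (Fin 2) (ZMod (p ^ (k + 1))))) :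
    conjCount (B0 (p ^ (k + 1))) (Subgroup.closure (kernelElement p hk '' A)) =
      Nat.card {g : GL2 (p ^ (k + 1)) | ∀ X ∈ A,
        redP p k (X 1 0 * g.1 1 1 ^ 2 + (X 0 0 - X 1 1) * (g.1 1 0 * g.1 1 1)
          - X 0 1 * g.1 1 0 ^ 2) = 0} := by
  simp only [conjCount, conj_closure_iff, Set.forall_mem_image, conj_kernelElement_mem_iff]

lemma exists_conjCount_closure_eq (hk : 0 < k) {m : ℕ}
    (hm : m = 0 ∨ m = p ^ k ∨ m = 2 * p ^ k ∨ m = p ^ (k + 1) + p ^ k) :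
    ∃ A : Set (Matrix (Fin 2) (Fin 2) (ZMod (p ^ (k + 1)))),
      conjCount (B0 (p ^ (k + 1))) (Subgroup.closure (kernelElement p hk '' A)) =
        m * Nat.card (B0 (p ^ (k + 1))) := by
  simp only [conjCount_closure_kernelElement]
  rcases hm with rfl | rfl | rfl | rfl
  · refine ⟨{!![0, 1; 0, 0], !![0, 0; 1, 0]}, ?_⟩
    rw [zero_mul]
    refine @Nat.card_of_isEmpty _ ⟨?_⟩
    rintro ⟨g, hg⟩
    have hdet := redP_det_ne_zero g
    simp at hg
    simp [hg] at hdet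
  · refine ⟨{!![0, 1; 0, 0]}, ?_⟩
    rw [← card_borelP]
    congr 2
    ext g
    simp [mem_borelP]
  · refine ⟨{!![1, 0; 0, 0]}, ?_⟩
    rw [← card_two_cosets (g₀ := 1) (g₁ := swap _)
      (by rw [mul_inv_mem_borelP]; simp [swap])]
    congr 2
    ext g
    simp only [Set.mem_ofPred_eq, mul_inv_mem_borelP]
    simp [swap]
  · exact ⟨∅, by rw [← card_GL2]; simp⟩

end PrimePower

end GL2Borel

theorem isogeny_count_lift_from_pk
    (p k : ℕ) (hp : p.Prime) (hodd : Odd p) (hk : 0 < k) :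
    -- (i) if `c_k(π(R)) = p^k + p^{k-1}` then `c_{k+1}(R) ∈ {0, p^k, 2p^k, p^{k+1} + p^k}`
    (∀ R : Subgroup (GL2 (p ^ (k + 1))), ∀ m : ℕ,
      conjCount (B0 (p ^ k)) (R.map (redGL p k)) =
        (p ^ k + p ^ (k - 1)) * Nat.card (B0 (p ^ k)) →
      conjCount (B0 (p ^ (k + 1))) R = m * Nat.card (B0 (p ^ (k + 1))) →
      m = 0 ∨ m = p ^ k ∨ m = 2 * p ^ k ∨ m = p ^ (k + 1) + p ^ k) ∧
    -- (i) conversely, each of the four values is achieved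
    (∀ m : ℕ, (m = 0 ∨ m = p ^ k ∨ m = 2 * p ^ k ∨ m = p ^ (k + 1) + p ^ k) →
      ∃ R : Subgroup (GL2 (p ^ (k + 1))),
        conjCount (B0 (p ^ k)) (R.map (redGL p k)) =
          (p ^ k + p ^ (k - 1)) * Nat.card (B0 (p ^ k)) ∧
        conjCount (B0 (p ^ (k + 1))) R = m * Nat.card (B0 (p ^ (k + 1)))) ∧
    -- (ii) if `c_k(π(R)) = 0` then `c_{k+1}(R) = 0`
    (∀ R : Subgroup (GL2 (p ^ (k + 1))),
      conjCount (B0 (p ^ k)) (R.map (redGL p k)) = 0 →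
      conjCount (B0 (p ^ (k + 1))) R = 0) := by
  have : Fact p.Prime := ⟨hp⟩
  obtain ⟨j, rfl⟩ : ∃ j, k = j + 1 := ⟨k - 1, by omega⟩
  simp only [Nat.add_sub_cancel]
  refine ⟨fun R m h hm => ?_, fun m hm => ?_, fun R h => ?_⟩
  · obtain ⟨m', hm', hc⟩ := GL2Borel.card_of_scalar_mod R ((GL2Borel.conjCount_eq_full_iff _).1 h)
    have hpos : 0 < Nat.card (B0 (p ^ (j + 1 + 1))) :=
      @Nat.card_pos _ ⟨⟨1, (GL2Borel.borel _).one_mem⟩⟩ _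
    rwa [Nat.eq_of_mul_eq_mul_right hpos (hm.symm.trans hc)]
  · obtain ⟨A, hA⟩ := GL2Borel.exists_conjCount_closure_eq hk hm
    refine ⟨_, ?_, hA⟩
    rw [GL2Borel.conjCount_eq_full_iff, GL2Borel.map_closure_kernelElement]
    intro r hr
    rw [Subgroup.mem_bot.1 hr]
    simp
  · rw [conjCount, Nat.card_coe_set_eq, Set.ncard_eq_zero, Set.eq_empty_iff_forall_notMem] at h ⊢
    intro g hg
    refine h (redGL p (j + 1) g) ?_
    rintro _ ⟨r, hr, rfl⟩
    rw [← map_inv, ← map_mul, ← map_mul]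
    have hg' : (g * r * g⁻¹).1 1 0 = 0 := hg r hr
    exact (congrArg (ZMod.castHom (pow_dvd_pow p (Nat.le_succ (j + 1))) (ZMod (p ^ (j + 1))))
      hg').trans (map_zero _)
end

section
/- Let p ≥ 13 be a prime, and let f and g be irreducible quadratic polynomials in 𝔽_p[x] with no common factors (equivalently, f and g are coprime in 𝔽_p[x]). Then there exists A ∈ 𝔽_p such that f(A) and g(A) are both nonzero squares in 𝔽_p, i.e., f(A) ≠ 0, g(A) ≠ 0, and there exist s, t ∈ 𝔽_p with f(A) = s² and g(A) = t². -/
open Polynomial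

/-- An irreducible quadratic polynomial has no roots. -/
theorem eval_ne_zero_of_irreducible_of_degree_eq_two {K : Type*} [Field K] {f : K[X]} (hf : f.degree = 2)
    (hirr : Irreducible f) (x : K) : f.eval x ≠ 0 := fun h => by
  have := degree_eq_one_of_irreducible_of_root hirr h
  rw [hf] at this
  exact absurd this (by decide)

section FiniteField

variable {F : Type*} [Field F] [Fintype F]

/-- A polynomial vanishing at every point of a finite field is divisible by `X ^ q - X`. -/
theorem X_pow_card_sub_X_dvd_of_forall_eval_eq_zero {P : F[X]} (hP : ∀ x, P.eval x = 0) :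
    X ^ Fintype.card F - X ∣ P := by
  rcases eq_or_ne P 0 with rfl | hP0
  · exact dvd_zero _
  have hsplits : (X ^ Fintype.card F - X : F[X]).Splits := by
    rw [splits_iff_card_roots, FiniteField.roots_X_pow_card_sub_X,
      FiniteField.X_pow_card_sub_X_natDegree_eq F Fintype.one_lt_card]
    rfl
  refine (hsplits.dvd_iff_roots_le_roots
    (FiniteField.X_pow_card_sub_X_ne_zero F Fintype.one_lt_card) hP0).2 ?_
  rw [FiniteField.roots_X_pow_card_sub_X]
  exact (Multiset.le_iff_subset Finset.univ.nodup).2 fun x _ => (mem_roots hP0).2 (hP x)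

/-- A separable polynomial of degree between `1` and `4` over a finite field with more than `9`
elements cannot take non-square values away from a single point. -/
theorem exists_ne_eval_pow_ne_neg_one (hF : ringChar F ≠ 2) (hcard : 9 < Fintype.card F)
    {h : F[X]} (hsep : h.Separable) (hpos : 0 < h.natDegree) (hdeg : h.natDegree ≤ 4)
    {c : F} (hc : h.eval c ≠ 0) :
    ∃ x, x ≠ c ∧ h.eval x ^ (Fintype.card F / 2) ≠ -1 := by
  by_contra! H
  set q := Fintype.card F with hq
  have hodd : 2 * (q / 2) + 1 = q := by
    have := FiniteField.odd_card_of_char_ne_two hF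
    omega
  set y : F[X] := X - C c with hy
  set S : F[X] := h ^ (q / 2) with hS
  set Φ : F[X] := X ^ q - X with hΦ
  have hΦdeg : Φ.natDegree = q := FiniteField.X_pow_card_sub_X_natDegree_eq F (by omega)
  have hΦ0 : Φ ≠ 0 := FiniteField.X_pow_card_sub_X_ne_zero F (by omega)
  have hy0 : y ≠ 0 := X_sub_C_ne_zero c
  have hy1 : y.natDegree ≤ 1 := (natDegree_X_sub_C c).le
  have hqF : (q : F) = 0 := FiniteField.cast_card_eq_zero F
  have dΦ : derivative Φ = -1 := by
    simp [hΦ, derivative_X_pow, hqF]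
  have dy : derivative y = 1 := by simp [hy]
  have dS : 2 * h * derivative S + derivative h * S = 0 := by
    have h1 : (2 * (q / 2 : ℕ) + 1 : F[X]) = 0 := by
      have : ((2 * (q / 2) + 1 : ℕ) : F[X]) = C (q : F) := by rw [hodd]; simp
      rw [hqF] at this
      simpa using this
    have h2 : S = h * h ^ (q / 2 - 1) := by
      rw [hS, ← pow_succ']
      congr 1
      omega
    have h3 : derivative S = (q / 2 : ℕ) * h ^ (q / 2 - 1) * derivative h := by
      rw [hS, derivative_pow]
      simp
    rw [h3]
    linear_combination (derivative h) * h2 + h * h ^ (q / 2 - 1) * derivative h * h1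
  obtain ⟨K, hK⟩ : Φ ∣ y * (S + 1) := by
    apply X_pow_card_sub_X_dvd_of_forall_eval_eq_zero
    intro x
    by_cases hx : x = c
    · simp [hy, hx]
    · simp [hS, H x hx]
  have hKdeg : K.natDegree ≤ q - 1 := by
    rcases eq_or_ne K 0 with rfl | hK0
    · simp
    have h1 := natDegree_mul hΦ0 hK0
    have h2 : (y * (S + 1)).natDegree ≤ 1 + (q / 2) * 4 := by
      refine natDegree_mul_le_of_le hy1 ((natDegree_add_le _ _).trans ?_)
      exact max_le (natDegree_pow_le_of_le (q / 2) hdeg) (by simp)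
    rw [hK] at h2
    omega
  have dK : S + 1 + y * derivative S = -K + Φ * derivative K := by
    have := congrArg derivative hK
    simp only [derivative_mul, derivative_add, derivative_one, dy, dΦ] at this
    linear_combination this
  obtain ⟨M, hM⟩ : ∃ M, M = 2 * h * y * derivative K + (derivative h * y - 2 * h) * K := ⟨_, rfl⟩
  have hΦM : Φ * M = y * (2 * h * K + derivative h * y) := by
    rw [hM]
    linear_combination (-2 * h * y) * dK - (derivative h * y - 2 * h) * hK + y ^ 2 * dS
  have hd : (derivative h).natDegree ≤ 3 := (natDegree_derivative_le h).trans (by omega)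
  have hdd : (derivative (derivative h)).natDegree ≤ 2 :=
    (natDegree_derivative_le _).trans (by omega)
  have h2 : (2 : F[X]).natDegree ≤ 0 := (natDegree_ofNat 2).le
  have h4 : (4 : F[X]).natDegree ≤ 0 := (natDegree_ofNat 4).le
  have hMdeg : M.natDegree ≤ 4 := by
    rcases eq_or_ne M 0 with h0 | hM0
    · simp [h0]
    have h1 := natDegree_mul hΦ0 hM0
    have h3 : (y * (2 * h * K + derivative h * y)).natDegree ≤ 1 + (q + 3) := by
      refine natDegree_mul_le_of_le hy1 (natDegree_add_le_of_degree_le ?_ ?_)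
      · exact (natDegree_mul_le_of_le (natDegree_mul_le_of_le h2 hdeg) hKdeg).trans (by omega)
      · exact (natDegree_mul_le_of_le hd hy1).trans (by omega)
    rw [← hΦM] at h3
    omega
  have dM := congrArg derivative hΦM
  simp only [derivative_mul, derivative_add, derivative_ofNat, dy, dΦ] at dM
  have key : Φ * (2 * h * y * derivative M - (derivative h * y + 4 * h) * M) =
      y * (4 * h * M + y ^ 2 * (2 * h * derivative (derivative h) - derivative h ^ 2)) := by
    linear_combination 2 * h * y * dM - (derivative h * y + 4 * h) * hΦM - 2 * h * y * hM
  have hzero : y * (4 * h * M + y ^ 2 * (2 * h * derivative (derivative h) - derivative h ^ 2))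
      = 0 := by
    refine eq_zero_of_dvd_of_natDegree_lt ⟨_, key.symm⟩ ?_
    rw [hΦdeg]
    refine lt_of_le_of_lt (natDegree_mul_le_of_le hy1
      (natDegree_add_le_of_degree_le (n := 8) ?_ ?_)) (by omega)
    · exact natDegree_mul_le_of_le (natDegree_mul_le_of_le h4 hdeg) hMdeg
    · refine natDegree_mul_le_of_le (m := 2) (n := 6) (natDegree_pow_le_of_le 2 hy1)
        ((natDegree_sub_le _ _).trans (max_le ?_ ?_))
      · exact natDegree_mul_le_of_le (natDegree_mul_le_of_le h2 hdeg) hdd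
      · exact natDegree_pow_le_of_le 2 hd
  have hdvd : h ∣ (y * derivative h) ^ 2 :=
    ⟨4 * M + y ^ 2 * (2 * derivative (derivative h)), by
      linear_combination -(mul_eq_zero.1 hzero).resolve_left hy0⟩
  have hcop : IsCoprime h y := by
    refine ((irreducible_X_sub_C c).coprime_iff_not_dvd.2 fun hdvd => hc ?_).symm
    exact dvd_iff_isRoot.1 hdvd
  have hunit : IsUnit h :=
    ((hcop.mul_right hsep).pow_right (n := 2)).isUnit_of_dvd' dvd_rfl hdvd
  exact hpos.ne' (natDegree_eq_zero_of_isUnit hunit)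

variable [DecidableEq F]

theorem sum_quadraticChar_sq_sub (hF : ringChar F ≠ 2) {D : F} (hD : D ≠ 0) :
    ∑ x : F, quadraticChar F (x ^ 2 - D) = -1 := by
  have hfib : ∑ x : F, quadraticChar F (x ^ 2 - D) =
      ∑ z : F, (quadraticChar F z + 1) * quadraticChar F (z - D) := by
    rw [← Finset.sum_fiberwise' Finset.univ (fun x : F => x ^ 2)
      (fun z => quadraticChar F (z - D))]
    refine Finset.sum_congr rfl fun z _ => ?_
    rw [Finset.sum_const, nsmul_eq_mul, ← quadraticChar_card_sqrts hF z]
    congr 3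
    ext
    simp
  have hshift : ∑ z : F, quadraticChar F (z - D) = 0 :=
    (Equiv.sum_comp (Equiv.subRight D) (quadraticChar F)).trans (quadraticChar_sum_zero hF)
  have hjac := jacobiSum_nontrivial_inv (quadraticChar_ne_one hF)
  rw [(quadraticChar_isQuadratic F).inv, jacobiSum] at hjac
  have hscale : ∑ z : F, quadraticChar F z * quadraticChar F (z - D) =
      ∑ w : F, quadraticChar F (-1) * (quadraticChar F w * quadraticChar F (1 - w)) := by
    rw [← Equiv.sum_comp (Equiv.mulLeft₀ D hD)]
    refine Finset.sum_congr rfl fun w _ => ?_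
    rw [Equiv.mulLeft₀_apply, ← map_mul, ← map_mul, ← map_mul,
      show D * w * (D * w - D) = D ^ 2 * (-1 * (w * (1 - w))) by ring, map_mul,
      quadraticChar_sq_one' hD, one_mul]
  have h1 := quadraticChar_sq_one (F := F) (neg_ne_zero.2 one_ne_zero)
  simp only [add_mul, one_mul, Finset.sum_add_distrib] at hfib
  rw [hfib, hshift, hscale, ← Finset.mul_sum, hjac]
  linear_combination -h1

/-- The sum of the quadratic character over the values of a quadratic polynomial with nonzero
discriminant. -/
theorem sum_quadraticChar_quadratic (hF : ringChar F ≠ 2) {a b c : F} (ha : a ≠ 0)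
    (hD : b ^ 2 - 4 * a * c ≠ 0) :
    ∑ x : F, quadraticChar F (a * x ^ 2 + b * x + c) = -quadraticChar F a := by
  have h2 : (2 : F) ≠ 0 := Ring.two_ne_zero hF
  have h := sum_quadraticChar_sq_sub hF hD
  rw [← ((Equiv.mulLeft₀ (2 * a) (mul_ne_zero h2 ha)).trans (Equiv.addRight b)).sum_comp] at h
  have hterm (x : F) : quadraticChar F ((2 * a * x + b) ^ 2 - (b ^ 2 - 4 * a * c)) =
      quadraticChar F a * quadraticChar F (a * x ^ 2 + b * x + c) := by
    rw [show (2 * a * x + b) ^ 2 - (b ^ 2 - 4 * a * c) =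
      2 ^ 2 * (a * (a * x ^ 2 + b * x + c)) by ring, map_mul, quadraticChar_sq_one' h2, one_mul,
      map_mul]
  simp only [Equiv.trans_apply, Equiv.mulLeft₀_apply, Equiv.coe_addRight, hterm] at h
  rw [← Finset.mul_sum] at h
  have h1 := quadraticChar_sq_one ha
  linear_combination quadraticChar F a * h -
    (∑ x : F, quadraticChar F (a * x ^ 2 + b * x + c)) * h1

theorem abs_sum_quadraticChar_eval_le_one (hF : ringChar F ≠ 2) {f : F[X]} (hf : f.degree = 2)
    (hirr : Irreducible f) :
    |∑ x : F, quadraticChar F (f.eval x)| ≤ 1 := by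
  obtain ⟨a, b, c, ha, rfl⟩ : ∃ a b c : F, a ≠ 0 ∧ f = C a * X ^ 2 + C b * X + C c :=
    ⟨_, _, _, coeff_ne_zero_of_eq_degree hf, eq_quadratic_of_degree_le_two hf.le⟩
  have h2 : (2 : F) ≠ 0 := Ring.two_ne_zero hF
  have hD : b ^ 2 - 4 * a * c ≠ 0 := fun hD => by
    refine eval_ne_zero_of_irreducible_of_degree_eq_two hf hirr (-b / (2 * a)) ?_
    simp only [eval_add, eval_mul, eval_C, eval_pow, eval_X]
    field_simp
    linear_combination -hD
  simp only [eval_add, eval_mul, eval_C, eval_pow, eval_X]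
  rw [sum_quadraticChar_quadratic hF ha hD]
  rcases quadraticChar_dichotomy ha with h | h <;> simp [h]

end FiniteField

theorem exists_simultaneous_nonzero_square_values
    (p : ℕ) (hp : p.Prime) (hp13 : 13 ≤ p)
    (f g : Polynomial (ZMod p))
    (hf : f.degree = 2) (hg : g.degree = 2)
    (hfirr : Irreducible f) (hgirr : Irreducible g)
    (hcop : IsCoprime f g) :
    ∃ A : ZMod p, f.eval A ≠ 0 ∧ g.eval A ≠ 0 ∧
      (∃ s : ZMod p, f.eval A = s ^ 2) ∧ (∃ t : ZMod p, g.eval A = t ^ 2) := by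
  have : Fact p.Prime := ⟨hp⟩
  have hF : ringChar (ZMod p) ≠ 2 := by rw [ZMod.ringChar_zmod_n]; omega
  set χ := quadraticChar (ZMod p) with hχ
  have hf0 := eval_ne_zero_of_irreducible_of_degree_eq_two hf hfirr
  have hg0 := eval_ne_zero_of_irreducible_of_degree_eq_two hg hgirr
  by_contra! H
  have hpt (x : ZMod p) : 1 + χ ((f * g).eval x) = -χ (f.eval x) - χ (g.eval x) := by
    rw [eval_mul, map_mul]
    rcases quadraticChar_dichotomy (hf0 x) with h1 | h1 <;>
      rcases quadraticChar_dichotomy (hg0 x) with h2 | h2 <;> rw [← hχ] at h1 h2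
    · obtain ⟨s, hs⟩ := (quadraticChar_one_iff_isSquare (hf0 x)).1 h1
      obtain ⟨t, ht⟩ := (quadraticChar_one_iff_isSquare (hg0 x)).1 h2
      exact absurd (ht.trans (sq t).symm) (H x (hf0 x) (hg0 x) ⟨s, hs.trans (sq s).symm⟩ t)
    all_goals simp [h1, h2]
  have hsum : ∑ x, (1 + χ ((f * g).eval x)) ≤ 2 := by
    simp only [hpt, Finset.sum_sub_distrib, Finset.sum_neg_distrib]
    linarith [neg_le_of_abs_le (abs_sum_quadraticChar_eval_le_one hF hf hfirr),
      neg_le_of_abs_le (abs_sum_quadraticChar_eval_le_one hF hg hgirr)]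
  have hfg0 (x : ZMod p) : (f * g).eval x ≠ 0 := by
    rw [eval_mul]
    exact mul_ne_zero (hf0 x) (hg0 x)
  have hnonneg (x : ZMod p) : 0 ≤ 1 + χ ((f * g).eval x) := by
    rcases quadraticChar_dichotomy (hfg0 x) with h | h <;> rw [hχ, h] <;> norm_num
  have hunique (x c : ZMod p) (hxc : x ≠ c) (hc : χ ((f * g).eval c) = 1) :
      χ ((f * g).eval x) = -1 := by
    refine (quadraticChar_dichotomy (hfg0 x)).resolve_left fun hx => ?_
    have hle := Finset.sum_le_sum_of_subset_of_nonneg (Finset.subset_univ {x, c})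
      fun i _ _ => hnonneg i
    rw [Finset.sum_pair hxc, hc, hχ, hx] at hle
    linarith
  obtain ⟨c, hc⟩ : ∃ c, ∀ x ≠ c, χ ((f * g).eval x) = -1 := by
    by_cases hex : ∃ c, χ ((f * g).eval c) = 1
    · obtain ⟨c, hc⟩ := hex
      exact ⟨c, fun x hx => hunique x c hx hc⟩
    · push Not at hex
      exact ⟨0, fun x _ => (quadraticChar_dichotomy (hfg0 x)).resolve_left (hex x)⟩
  have hdeg : (f * g).natDegree = 4 := by
    rw [natDegree_mul hfirr.ne_zero hgirr.ne_zero, natDegree_eq_of_degree_eq_some hf,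
      natDegree_eq_of_degree_eq_some hg]
  have hsep : (f * g).Separable :=
    (PerfectField.separable_of_irreducible hfirr).mul
      (PerfectField.separable_of_irreducible hgirr) hcop
  obtain ⟨x, hx, hne⟩ := exists_ne_eval_pow_ne_neg_one hF (by rw [ZMod.card]; omega) hsep
    (by omega) hdeg.le (hfg0 c)
  refine hne ?_
  rw [← quadraticChar_eq_pow_of_char_ne_two' hF, ← hχ, hc x hx]
  simp
end
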